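/- A sequence (G_n) of finite graphs with maximum degree at most d such that lim_{n→∞} |G_n| = ∞ is FO-convergent if and only if it is both BS-convergent and elementarily convergent. -/

import Mathlib

open FirstOrder Filter

/-- A finite nonempty graph (bundled). -/
structure FinGraph where
  V : Type
  graph : SimpleGraph V
  [fin : Fintype V]
  [nonempty : Nonempty V]

attribute [instance] FinGraph.fin FinGraph.nonempty

/-- The density `⟨φ,G⟩` of a first-order formula `φ` of the language of graphs with `p` free
variables in a finite graph `G`: the proportion of `p`-tuples of vertices satisfying `φ`. -/
noncomputable def gDens {V : Type} (G : SimpleGraph V) {p : ℕ}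
    (φ : Language.graph.Formula (Fin p)) : ℝ :=
  haveI := G.structure
  (Nat.card {v : Fin p → V // φ.Realize v} : ℝ) / (Nat.card V : ℝ) ^ p

/-- Satisfaction of a first-order sentence in a graph. -/
def gSat {V : Type} (G : SimpleGraph V) (φ : Language.graph.Sentence) : Prop :=
  haveI := G.structure
  Language.Sentence.Realize V φ

/-- The set of vertices at distance at most `r` from the set `S` in the graph `G`. -/
def ballSet {V : Type} (G : SimpleGraph V) (r : ℕ) (S : Set V) : Set V :=
  {u | ∃ s ∈ S, ∃ w : G.Walk s u, w.length ≤ r}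

/-- Rooted-graph isomorphism: a graph isomorphism mapping root to root. -/
def RootedIso {A B : Type*} (G : SimpleGraph A) (a : A) (H : SimpleGraph B) (b : B) : Prop :=
  ∃ e : G ≃g H, e a = b

/-- `B_G(x,r)`: the subgraph of `G` induced by the vertices at distance at most `r`
from `x`, rooted at `x` (see `ballRoot`). -/
def ballAt {V : Type} (G : SimpleGraph V) (x : V) (r : ℕ) : SimpleGraph (ballSet G r {x}) :=
  G.induce (ballSet G r {x})

/-- The root of the ball `B_G(x,r)`. -/
def ballRoot {V : Type} (G : SimpleGraph V) (x : V) (r : ℕ) : ballSet G r {x} :=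
  ⟨x, x, rfl, SimpleGraph.Walk.nil, Nat.zero_le r⟩

/-- The graph `G` has maximum degree at most `d`. -/
def DegLE {V : Type} (G : SimpleGraph V) (d : ℕ) : Prop :=
  ∀ x : V, Nat.card (G.neighborSet x) ≤ d

/-- `FO`-convergence: the densities of all first-order formulas converge. -/
def FOConv (Gs : ℕ → FinGraph) : Prop :=
  ∀ (p : ℕ) (φ : Language.graph.Formula (Fin p)),
    ∃ ℓ : ℝ, Tendsto (fun n => gDens (Gs n).graph φ) atTop (nhds ℓ)

/-- BS-convergence: for every radius `r` and every finite rooted connected graph `(F,o)`,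
the proportion of vertices whose `r`-ball is isomorphic to `(F,o)` converges. -/
def BSConv (Gs : ℕ → FinGraph) : Prop :=
  ∀ (r : ℕ) (W : Type) [Fintype W] (F : SimpleGraph W) (o : W), F.Connected →
    ∃ ℓ : ℝ, Tendsto
      (fun n => (Nat.card {x : (Gs n).V //
          RootedIso (ballAt (Gs n).graph x r) (ballRoot (Gs n).graph x r) F o} : ℝ) /
        (Nat.card (Gs n).V : ℝ)) atTop (nhds ℓ)

/-- Elementary convergence: for every sentence `φ`, eventually either all graphs of the
sequence satisfy `φ` or none of them does. -/
def ElemConv (Gs : ℕ → FinGraph) : Prop :=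
  ∀ φ : Language.graph.Sentence, ∃ N : ℕ,
    (∀ n ≥ N, gSat (Gs n).graph φ) ∨ (∀ n ≥ N, ¬ gSat (Gs n).graph φ)


namespace FOBS

/-! ### Balls -/

section Balls
variable {V : Type} {G : SimpleGraph V}

lemma mem_ball_self {r : ℕ} {A : Set V} {x : V} (h : x ∈ A) : x ∈ ballSet G r A :=
  ⟨x, h, SimpleGraph.Walk.nil, Nat.zero_le r⟩

lemma ball_zero (A : Set V) : ballSet G 0 A = A := by
  ext u
  constructor
  · rintro ⟨s, hs, w, hw⟩
    have := SimpleGraph.Walk.eq_of_length_eq_zero (Nat.le_zero.1 hw)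
    exact this ▸ hs
  · exact mem_ball_self

lemma ball_mono {r s : ℕ} {A B : Set V} (hrs : r ≤ s) (hAB : A ⊆ B) :
    ballSet G r A ⊆ ballSet G s B := by
  rintro u ⟨a, ha, w, hw⟩
  exact ⟨a, hAB ha, w, hw.trans hrs⟩

lemma ball_ball {r s : ℕ} {A : Set V} : ballSet G r (ballSet G s A) ⊆ ballSet G (s + r) A := by
  rintro u ⟨a, ⟨b, hb, w', hw'⟩, w, hw⟩
  exact ⟨b, hb, w'.append w, by rw [SimpleGraph.Walk.length_append]; omega⟩

lemma ball_symm {r : ℕ} {x y : V} (h : x ∈ ballSet G r {y}) : y ∈ ballSet G r {x} := by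
  obtain ⟨s, rfl, w, hw⟩ := h
  exact ⟨x, rfl, w.reverse, by simpa using hw⟩

lemma ball_iUnion {ι : Sort*} {r : ℕ} (A : ι → Set V) :
    ballSet G r (⋃ i, A i) = ⋃ i, ballSet G r (A i) := by
  ext u
  simp only [ballSet, Set.mem_iUnion, Set.mem_ofPred_eq]
  constructor
  · rintro ⟨s, ⟨i, hi⟩, h⟩
    exact ⟨i, s, hi, h⟩
  · rintro ⟨i, s, hi, h⟩
    exact ⟨s, ⟨i, hi⟩, h⟩

lemma mem_ball_iff {r : ℕ} {A : Set V} {u : V} :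
    u ∈ ballSet G r A ↔ ∃ a ∈ A, u ∈ ballSet G r {a} := by
  constructor
  · rintro ⟨a, ha, h⟩
    exact ⟨a, ha, a, rfl, h⟩
  · rintro ⟨a, ha, _, rfl, h⟩
    exact ⟨_, ha, h⟩

lemma mem_ball_succ {r : ℕ} {A : Set V} {u : V} :
    u ∈ ballSet G (r + 1) A ↔ ∃ z ∈ ballSet G r A, z = u ∨ G.Adj z u := by
  constructor
  · rintro ⟨a, ha, w, hw⟩
    by_cases h0 : w.length ≤ r
    · exact ⟨u, ⟨a, ha, w, h0⟩, Or.inl rfl⟩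
    · have hl : w.reverse.length = r + 1 := by rw [SimpleGraph.Walk.length_reverse]; omega
      cases hw' : w.reverse with
      | nil => rw [hw'] at hl; simp at hl
      | cons h p =>
        rw [hw'] at hl
        simp only [SimpleGraph.Walk.length_cons] at hl
        exact ⟨_, ⟨a, ha, p.reverse, by simp; omega⟩, Or.inr h.symm⟩
  · rintro ⟨z, ⟨a, ha, w, hw⟩, rfl | h⟩
    · exact ⟨a, ha, w, by omega⟩
    · exact ⟨a, ha, w.append (SimpleGraph.Walk.cons h SimpleGraph.Walk.nil), by simp; omega⟩

lemma ball_card [Finite V] {d : ℕ} (hd : DegLE G d) (A : Set V) (r : ℕ) :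
    (ballSet G r A).ncard ≤ A.ncard * (d + 1) ^ r := by
  classical
  induction r with
  | zero => simp [ball_zero]
  | succ r ih =>
    have hsub : ballSet G (r + 1) A ⊆ ⋃ z ∈ (Set.toFinite (ballSet G r A)).toFinset,
        insert z (G.neighborSet z) := by
      intro u hu
      obtain ⟨z, hz, h⟩ := mem_ball_succ.1 hu
      simp only [Set.mem_iUnion]
      refine ⟨z, by simpa using hz, ?_⟩
      rcases h with rfl | h
      · simp
      · exact Or.inr h
    calc (ballSet G (r + 1) A).ncard ≤ _ := Set.ncard_le_ncard hsub (Set.toFinite _)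
      _ ≤ ∑ z ∈ (Set.toFinite (ballSet G r A)).toFinset, (insert z (G.neighborSet z)).ncard :=
          Finset.set_ncard_biUnion_le _ _
      _ ≤ ∑ z ∈ (Set.toFinite (ballSet G r A)).toFinset, (d + 1) := by
          refine Finset.sum_le_sum fun z _ => ?_
          refine (Set.ncard_insert_le _ _).trans ?_
          have := hd z
          rw [Nat.card_coe_set_eq] at this
          omega
      _ = (ballSet G r A).ncard * (d + 1) := by
          rw [Finset.sum_const, smul_eq_mul, Set.ncard_eq_toFinset_card _ (Set.toFinite _)]
      _ ≤ _ := by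
          rw [pow_succ, ← mul_assoc]
          exact Nat.mul_le_mul_right _ ih

end Balls

/-! ### Partial isomorphisms -/

section PI
variable {V W : Type} {G : SimpleGraph V} {H : SimpleGraph W}

/-- The map restricts to an isomorphism between the two induced subgraphs. -/
def PI (G : SimpleGraph V) (H : SimpleGraph W) (f : V → W) (D : Set V) (D' : Set W) : Prop :=
  Set.BijOn f D D' ∧ ∀ a ∈ D, ∀ b ∈ D, (G.Adj a b ↔ H.Adj (f a) (f b))

lemma PI.image_ball {f : V → W} {D : Set V} {D' : Set W} (h : PI G H f D D') {A : Set V} {s : ℕ}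
    (h1 : ballSet G s A ⊆ D) (h2 : ballSet H s (f '' A) ⊆ D') :
    f '' ballSet G s A = ballSet H s (f '' A) := by
  induction s with
  | zero => simp [ball_zero]
  | succ s ih =>
    have m1 : ballSet G s A ⊆ ballSet G (s + 1) A := ball_mono (Nat.le_succ s) subset_rfl
    have m2 : ballSet H s (f '' A) ⊆ ballSet H (s + 1) (f '' A) :=
      ball_mono (Nat.le_succ s) subset_rfl
    have ih := ih (m1.trans h1) (m2.trans h2)
    ext u
    constructor
    · rintro ⟨a, ha, rfl⟩
      obtain ⟨z, hz, hza⟩ := mem_ball_succ.1 ha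
      refine mem_ball_succ.2 ⟨f z, ih ▸ Set.mem_image_of_mem f hz, ?_⟩
      rcases hza with rfl | hza
      · exact Or.inl rfl
      · exact Or.inr ((h.2 _ (h1 (m1 hz)) _ (h1 ha)).1 hza)
    · intro hu
      obtain ⟨z, hz, hzu⟩ := mem_ball_succ.1 hu
      rw [← ih] at hz
      obtain ⟨z, hz, rfl⟩ := hz
      obtain ⟨a, ha, rfl⟩ := h.1.surjOn (h2 hu)
      refine ⟨a, mem_ball_succ.2 ⟨z, hz, ?_⟩, rfl⟩
      rcases hzu with e | hzu
      · exact Or.inl (h.1.injOn (h1 (m1 hz)) ha e)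
      · exact Or.inr ((h.2 _ (h1 (m1 hz)) _ ha).2 hzu)

lemma PI.restrict {f : V → W} {D : Set V} {D' : Set W} (h : PI G H f D D') {A : Set V} {s : ℕ}
    (h1 : ballSet G s A ⊆ D) (h2 : ballSet H s (f '' A) ⊆ D') :
    PI G H f (ballSet G s A) (ballSet H s (f '' A)) := by
  refine ⟨?_, fun a ha b hb => h.2 a (h1 ha) b (h1 hb)⟩
  rw [← h.image_ball h1 h2]
  exact (h.1.injOn.mono h1).bijOn_image

lemma PI.symm [Nonempty V] {f : V → W} {D : Set V} {D' : Set W} (h : PI G H f D D') :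
    ∃ g : W → V, PI H G g D' D ∧ ∀ a ∈ D, g (f a) = a := by
  have hinv := h.1.invOn_invFunOn
  refine ⟨Function.invFunOn f D, ⟨h.1.symm hinv.symm, ?_⟩, fun a ha => hinv.1 ha⟩
  intro a ha b hb
  have ma : Function.invFunOn f D a ∈ D := (h.1.symm hinv.symm).mapsTo ha
  have mb : Function.invFunOn f D b ∈ D := (h.1.symm hinv.symm).mapsTo hb
  rw [h.2 _ ma _ mb, hinv.2 ha, hinv.2 hb]

/-- The sets are disjoint and have no edges in between. -/
def Sep (G : SimpleGraph V) (D E : Set V) : Prop :=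
  ∀ a ∈ D, ∀ b ∈ E, a ≠ b ∧ ¬ G.Adj a b

lemma sep_balls {A : Set V} {B : Set V} {r : ℕ}
    (h : ∀ x ∈ B, x ∉ ballSet G (2 * r + 1) A) : Sep G (ballSet G r A) (ballSet G r B) := by
  have key : ∀ a ∈ ballSet G r A, ∀ b ∈ ballSet G r B, ¬ (a = b ∨ G.Adj a b) := by
    intro a ha b hb hab
    have hb1 : b ∈ ballSet G (r + 1) A := mem_ball_succ.2 ⟨a, ha, hab⟩
    obtain ⟨x, hx, hbx⟩ := mem_ball_iff.1 hb
    have := ball_ball (ball_mono (le_refl r) (Set.singleton_subset_iff.2 hb1) (ball_symm hbx))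
    exact h x hx (ball_mono (by omega) subset_rfl this)
  intro a ha b hb
  have := key a ha b hb
  tauto

lemma Sep.symm {D E : Set V} (h : Sep G D E) : Sep G E D := fun a ha b hb =>
  ⟨(h b hb a ha).1.symm, fun e => (h b hb a ha).2 e.symm⟩

lemma glue {κ : Type} (f : κ → V → W) (f0 : V → W) (D : κ → Set V) (D' : κ → Set W)
    (hf : ∀ k, PI G H (f k) (D k) (D' k))
    (hG : ∀ k l, k ≠ l → Sep G (D k) (D l)) (hH : ∀ k l, k ≠ l → Sep H (D' k) (D' l)) :
    ∃ F : V → W, PI G H F (⋃ k, D k) (⋃ k, D' k) ∧ ∀ k, ∀ u ∈ D k, F u = f k u := by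
  classical
  let F : V → W := fun u => if h : ∃ k, u ∈ D k then f h.choose u else f0 u
  have hF : ∀ k, ∀ u ∈ D k, F u = f k u := by
    intro k u hu
    have h : ∃ k, u ∈ D k := ⟨k, hu⟩
    have : h.choose = k := by
      by_contra hne
      exact (hG _ _ hne u h.choose_spec u hu).1 rfl
    simp only [F, dif_pos h, this]
  have hm : ∀ k, ∀ u ∈ D k, F u ∈ D' k := fun k u hu => hF k u hu ▸ (hf k).1.mapsTo hu
  refine ⟨F, ⟨⟨?_, ?_, ?_⟩, ?_⟩, hF⟩
  · intro u hu
    obtain ⟨k, hk⟩ := Set.mem_iUnion.1 hu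
    exact Set.mem_iUnion.2 ⟨k, hm k u hk⟩
  · intro u hu u' hu' e
    obtain ⟨k, hk⟩ := Set.mem_iUnion.1 hu
    obtain ⟨l, hl⟩ := Set.mem_iUnion.1 hu'
    by_cases hkl : k = l
    · subst hkl
      rw [hF k u hk, hF k u' hl] at e
      exact (hf k).1.injOn hk hl e
    · exact absurd e (hH k l hkl _ (hm k u hk) _ (hm l u' hl)).1
  · intro y hy
    obtain ⟨k, hk⟩ := Set.mem_iUnion.1 hy
    obtain ⟨u, hu, rfl⟩ := (hf k).1.surjOn hk
    exact ⟨u, Set.mem_iUnion.2 ⟨k, hu⟩, hF k u hu⟩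
  · intro u hu u' hu'
    obtain ⟨k, hk⟩ := Set.mem_iUnion.1 hu
    obtain ⟨l, hl⟩ := Set.mem_iUnion.1 hu'
    by_cases hkl : k = l
    · subst hkl
      rw [hF k u hk, hF k u' hl]
      exact (hf k).2 _ hk _ hl
    · have a1 := (hG k l hkl _ hk _ hl).2
      have a2 := (hH k l hkl _ (hm k u hk) _ (hm l u' hl)).2
      tauto

/-- Local isomorphism of tuples: the `r`-balls around the tuples are isomorphic. -/
def LI {ι : Type} (r : ℕ) (G : SimpleGraph V) (v : ι → V) (H : SimpleGraph W) (w : ι → W) : Prop :=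
  ∃ f : V → W, PI G H f (ballSet G r (Set.range v)) (ballSet H r (Set.range w)) ∧
    ∀ i, f (v i) = w i

lemma LI.mono {ι : Type} {r s : ℕ} {v : ι → V} {w : ι → W} (h : LI s G v H w) (hrs : r ≤ s) :
    LI r G v H w := by
  obtain ⟨f, hf, hv⟩ := h
  have e : f '' Set.range v = Set.range w := by
    rw [← Set.range_comp]; congr 1; exact funext hv
  refine ⟨f, ?_, hv⟩
  have := hf.restrict (A := Set.range v) (s := r) (ball_mono hrs subset_rfl)
    (by rw [e]; exact ball_mono hrs subset_rfl)
  rwa [e] at this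

lemma LI.symm [Nonempty V] {ι : Type} {r : ℕ} {v : ι → V} {w : ι → W} (h : LI r G v H w) :
    LI r H w G v := by
  obtain ⟨f, hf, hv⟩ := h
  obtain ⟨g, hg, hgf⟩ := hf.symm
  refine ⟨g, hg, fun i => ?_⟩
  rw [← hv i]
  exact hgf _ (mem_ball_self ⟨i, rfl⟩)

/-- Ball isomorphism as an embedding. -/
def BT {U : Type} (r : ℕ) (F : SimpleGraph U) (o : U) (G : SimpleGraph V) (x : V) : Prop :=
  ∃ f : U → V, f o = x ∧ (∀ a b, a ≠ b → ¬ f a = f b) ∧ (∀ a b, F.Adj a b ↔ G.Adj (f a) (f b)) ∧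
    (∀ a, f a ∈ ballSet G r {x}) ∧ ∀ z ∈ ballSet G r {x}, ∃ a, z = f a

lemma rootedIso_iff {U : Type} {r : ℕ} {F : SimpleGraph U} {o : U} {x : V} :
    RootedIso (ballAt G x r) (ballRoot G x r) F o ↔ BT r F o G x := by
  constructor
  · rintro ⟨e, he⟩
    refine ⟨fun a => (e.symm a).1, ?_, ?_, ?_, fun a => (e.symm a).2, fun z hz => ⟨e ⟨z, hz⟩, by simp⟩⟩
    · rw [← he]; simp [ballRoot]
    · intro a b hab h
      exact hab (e.symm.injective (Subtype.ext h))
    · intro a b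
      exact e.symm.map_rel_iff.symm
  · rintro ⟨f, ho, hi, ha, hm, hs⟩
    have hbij : Function.Bijective (fun a => (⟨f a, hm a⟩ : ballSet G r {x})) := by
      refine ⟨fun a b h => ?_, fun z => ?_⟩
      · by_contra hab
        exact hi a b hab (congrArg Subtype.val h)
      · obtain ⟨a, ha⟩ := hs z.1 z.2
        exact ⟨a, Subtype.ext ha.symm⟩
    let e : F ≃g ballAt G x r := ⟨Equiv.ofBijective _ hbij, by
      intro a b
      exact (ha a b).symm⟩
    refine ⟨e.symm, ?_⟩
    rw [RelIso.symm_apply_eq]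
    exact Subtype.ext ho.symm

/-- Two vertices whose balls are isomorphic to the same rooted graph. -/
lemma BT.pi {U : Type} {r : ℕ} {F : SimpleGraph U} {o : U} {x : V} {y : W}
    (hx : BT r F o G x) (hy : BT r F o H y) :
    ∃ f, PI G H f (ballSet G r {x}) (ballSet H r {y}) ∧ f x = y := by
  obtain ⟨f, ho, hi, ha, hm, hs⟩ := hx
  obtain ⟨f', ho', hi', ha', hm', hs'⟩ := hy
  have : Nonempty U := ⟨o⟩
  have finj : Function.Injective f := fun a b h => by by_contra hab; exact hi a b hab h
  have finj' : Function.Injective f' := fun a b h => by by_contra hab; exact hi' a b hab h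
  have hg : ∀ a, Function.invFun f (f a) = a := Function.leftInverse_invFun finj
  refine ⟨fun u => f' (Function.invFun f u), ⟨⟨fun u _ => hm' _, ?_, ?_⟩, ?_⟩, ?_⟩
  · intro u hu u' hu' e
    obtain ⟨a, rfl⟩ := hs u hu
    obtain ⟨b, rfl⟩ := hs u' hu'
    simp only [hg] at e
    rw [finj' e]
  · intro z hz
    obtain ⟨a, rfl⟩ := hs' z hz
    exact ⟨f a, hm a, by simp only [hg]⟩
  · intro u hu u' hu'
    obtain ⟨a, rfl⟩ := hs u hu
    obtain ⟨b, rfl⟩ := hs u' hu'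
    simp only [hg]
    rw [← ha, ha']
  · simp only [← ho, hg, ho']

lemma BT.trans_pi {U : Type} {r : ℕ} {F : SimpleGraph U} {o : U} {x : V} {f : V → W}
    (hx : BT r F o G x) (h : PI G H f (ballSet G r {x}) (ballSet H r {f x})) :
    BT r F o H (f x) := by
  obtain ⟨g, ho, hi, ha, hm, hs⟩ := hx
  refine ⟨fun a => f (g a), by simp only [ho], ?_, ?_, fun a => h.1.mapsTo (hm a), ?_⟩
  · intro a b hab e
    exact hi a b hab (h.1.injOn (hm a) (hm b) e)
  · intro a b
    rw [ha, h.2 _ (hm a) _ (hm b)]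
  · intro z hz
    obtain ⟨u, hu, rfl⟩ := h.1.surjOn hz
    obtain ⟨a, rfl⟩ := hs u hu
    exact ⟨a, rfl⟩

end PI

/-! ### Uniform definability -/

section Def

open Language

/-- `P` is uniformly first-order definable. -/
def UD {α : Type} (P : ∀ V : Type, SimpleGraph V → (α → V) → Prop) : Prop :=
  ∃ φ : Language.graph.Formula α, ∀ (V : Type) (G : SimpleGraph V) (v : α → V),
    @Formula.Realize Language.graph V G.structure α φ v ↔ P V G v

variable {α β : Type}

lemma UD.eq (i j : α) : UD (fun _ _ (v : α → _) => v i = v j) :=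
  ⟨Term.equal (Term.var i) (Term.var j), fun V G v => by
    let _ := G.structure
    simp⟩

lemma UD.adj (i j : α) : UD (fun _ G (v : α → _) => G.Adj (v i) (v j)) :=
  ⟨Relations.formula₂ Language.adj (Term.var i) (Term.var j), fun V G v => by
    let _ := G.structure
    rw [Formula.realize_rel₂]
    rfl⟩

lemma UD.not {P : ∀ V : Type, SimpleGraph V → (α → V) → Prop} (h : UD P) :
    UD (fun V G v => ¬ P V G v) := by
  obtain ⟨φ, hφ⟩ := h
  refine ⟨φ.not, fun V G v => ?_⟩
  let _ := G.structure
  rw [Formula.realize_not, hφ]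

lemma UD.and {P Q : ∀ V : Type, SimpleGraph V → (α → V) → Prop} (h : UD P) (h' : UD Q) :
    UD (fun V G v => P V G v ∧ Q V G v) := by
  obtain ⟨φ, hφ⟩ := h
  obtain ⟨ψ, hψ⟩ := h'
  refine ⟨φ ⊓ ψ, fun V G v => ?_⟩
  let _ := G.structure
  rw [Formula.realize_inf, hφ, hψ]

lemma UD.or {P Q : ∀ V : Type, SimpleGraph V → (α → V) → Prop} (h : UD P) (h' : UD Q) :
    UD (fun V G v => P V G v ∨ Q V G v) := by
  obtain ⟨φ, hφ⟩ := h
  obtain ⟨ψ, hψ⟩ := h'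
  refine ⟨φ ⊔ ψ, fun V G v => ?_⟩
  let _ := G.structure
  rw [Formula.realize_sup, hφ, hψ]

lemma UD.imp {P Q : ∀ V : Type, SimpleGraph V → (α → V) → Prop} (h : UD P) (h' : UD Q) :
    UD (fun V G v => P V G v → Q V G v) := by
  obtain ⟨φ, hφ⟩ := h
  obtain ⟨ψ, hψ⟩ := h'
  refine ⟨φ.imp ψ, fun V G v => ?_⟩
  let _ := G.structure
  rw [Formula.realize_imp, hφ, hψ]

lemma UD.iff {P Q : ∀ V : Type, SimpleGraph V → (α → V) → Prop} (h : UD P) (h' : UD Q) :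
    UD (fun V G v => (P V G v ↔ Q V G v)) := by
  obtain ⟨φ, hφ⟩ := h
  obtain ⟨ψ, hψ⟩ := h'
  refine ⟨φ.iff ψ, fun V G v => ?_⟩
  let _ := G.structure
  rw [Formula.realize_iff, hφ, hψ]

lemma UD.const (p : Prop) : UD (fun _ _ (_ : α → _) => p) := by
  by_cases hp : p
  · exact ⟨⊤, fun V G v => by let _ := G.structure; simp [hp]⟩
  · exact ⟨⊥, fun V G v => by let _ := G.structure; simp [hp]⟩

lemma UD.fall [Finite β] {P : β → ∀ V : Type, SimpleGraph V → (α → V) → Prop}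
    (h : ∀ b, UD (P b)) : UD (fun V G v => ∀ b, P b V G v) := by
  choose φ hφ using h
  refine ⟨Formula.iInf φ, fun V G v => ?_⟩
  let _ := G.structure
  rw [Formula.realize_iInf]
  exact forall_congr' fun b => hφ b V G v

lemma UD.fex [Finite β] {P : β → ∀ V : Type, SimpleGraph V → (α → V) → Prop}
    (h : ∀ b, UD (P b)) : UD (fun V G v => ∃ b, P b V G v) := by
  choose φ hφ using h
  refine ⟨Formula.iSup φ, fun V G v => ?_⟩
  let _ := G.structure
  rw [Formula.realize_iSup]
  exact exists_congr fun b => hφ b V G v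

lemma UD.ex [Finite β] {P : ∀ V : Type, SimpleGraph V → (α → V) → (β → V) → Prop}
    (h : UD (fun V G (v : α ⊕ β → V) => P V G (fun i => v (Sum.inl i)) (fun j => v (Sum.inr j)))) :
    UD (fun V G v => ∃ f : β → V, P V G v f) := by
  obtain ⟨φ, hφ⟩ := h
  refine ⟨φ.iExs β, fun V G v => ?_⟩
  let _ := G.structure
  rw [Formula.realize_iExs]
  exact exists_congr fun f => hφ V G (Sum.elim v f)

lemma UD.all [Finite β] {P : ∀ V : Type, SimpleGraph V → (α → V) → (β → V) → Prop}
    (h : UD (fun V G (v : α ⊕ β → V) => P V G (fun i => v (Sum.inl i)) (fun j => v (Sum.inr j)))) :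
    UD (fun V G v => ∀ f : β → V, P V G v f) := by
  obtain ⟨φ, hφ⟩ := h
  refine ⟨φ.iAlls β, fun V G v => ?_⟩
  let _ := G.structure
  rw [Formula.realize_iAlls]
  exact forall_congr' fun f => hφ V G (Sum.elim v f)

lemma UD.congr {P Q : ∀ V : Type, SimpleGraph V → (α → V) → Prop} (h : UD P)
    (e : ∀ V G v, P V G v ↔ Q V G v) : UD Q := by
  obtain ⟨φ, hφ⟩ := h
  exact ⟨φ, fun V G v => (hφ V G v).trans (e V G v)⟩

lemma UD.ball (r : ℕ) : ∀ {α : Type} (i j : α),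
    UD (fun V G (v : α → V) => v j ∈ ballSet G r {v i}) := by
  induction r with
  | zero =>
    intro α i j
    refine (UD.eq j i).congr fun V G v => ?_
    rw [ball_zero]; rfl
  | succ r ih =>
    intro α i j
    have : UD (fun V G (v : α → V) => ∃ f : Unit → V, f () ∈ ballSet G r {v i} ∧
        (f () = v j ∨ G.Adj (f ()) (v j))) :=
      UD.ex ((ih (Sum.inl i) (Sum.inr ())).and
        ((UD.eq (Sum.inr ()) (Sum.inl j)).or (UD.adj (Sum.inr ()) (Sum.inl j))))
    refine this.congr fun V G v => ?_
    rw [mem_ball_succ]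
    exact ⟨fun ⟨f, h⟩ => ⟨f (), h⟩, fun ⟨z, h⟩ => ⟨fun _ => z, h⟩⟩

lemma UD.bt {U : Type} [Finite U] (r : ℕ) (F : SimpleGraph U) (o : U) {α : Type} (i : α) :
    UD (fun _ G (v : α → _) => BT r F o G (v i)) := by
  have : UD (fun V G (v : α → V) => ∃ f : U → V, f o = v i ∧ (∀ a b, a ≠ b → ¬ f a = f b) ∧
      (∀ a b, F.Adj a b ↔ G.Adj (f a) (f b)) ∧ (∀ a, f a ∈ ballSet G r {v i}) ∧
      ∀ g : Unit → V, g () ∈ ballSet G r {v i} → ∃ a, g () = f a) := by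
    refine UD.ex ((UD.eq (Sum.inr o) (Sum.inl i)).and (UD.and ?_ (UD.and ?_ (UD.and ?_ ?_))))
    · exact UD.fall fun a => UD.fall fun b => (UD.const _).imp (UD.eq (Sum.inr a) (Sum.inr b)).not
    · exact UD.fall fun a => UD.fall fun b => (UD.const _).iff (UD.adj (Sum.inr a) (Sum.inr b))
    · exact UD.fall fun a => UD.ball r (Sum.inl i) (Sum.inr a)
    · exact UD.all ((UD.ball r (Sum.inl (Sum.inl i)) (Sum.inr ())).imp
        (UD.fex fun a => UD.eq (Sum.inr ()) (Sum.inl (Sum.inr a))))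
  refine this.congr fun V G v => ?_
  unfold BT
  refine exists_congr fun f => and_congr_right fun _ => and_congr_right fun _ =>
    and_congr_right fun _ => and_congr_right fun _ => ?_
  exact ⟨fun h z hz => h (fun _ => z) hz, fun h g hg => h (g ()) hg⟩

/-- A sentence saying that at least `m` vertices have the given ball type. -/
lemma exists_count_sentence {U : Type} [Finite U] (r : ℕ) (F : SimpleGraph U) (o : U) (m : ℕ) :
    ∃ σ : Language.graph.Sentence, ∀ (V : Type) [Finite V] (G : SimpleGraph V),
      gSat G σ ↔ m ≤ {x | BT r F o G x}.ncard := by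
  have : UD (fun V G (_ : Empty → V) => ∃ f : Fin m → V, (∀ a b, a ≠ b → ¬ f a = f b) ∧
      ∀ a, BT r F o G (f a)) :=
    UD.ex (UD.and
      (UD.fall fun a => UD.fall fun b => (UD.const _).imp (UD.eq (Sum.inr a) (Sum.inr b)).not)
      (UD.fall fun a => UD.bt r F o (Sum.inr a)))
  obtain ⟨σ, hσ⟩ := this
  refine ⟨σ, fun V _ G => (hσ V G default).trans ?_⟩
  constructor
  · rintro ⟨f, hi, hb⟩
    have finj : Function.Injective f := fun a b h => by by_contra hab; exact hi a b hab h
    calc m = (Set.range f).ncard := by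
          rw [← Set.image_univ, Set.ncard_image_of_injective _ finj]; simp
      _ ≤ _ := Set.ncard_le_ncard (by rintro _ ⟨a, rfl⟩; exact hb a) (Set.toFinite _)
  · intro h
    obtain ⟨s, hs, hc⟩ := Set.exists_subset_card_eq h
    have e : Nonempty (Fin m ≃ s) := by
      rw [← hc]
      have := Finite.equivFin s
      rw [Nat.card_coe_set_eq] at this
      exact ⟨this.symm⟩
    obtain ⟨e⟩ := e
    exact ⟨fun a => (e a).1, fun a b hab h => hab (e.injective (Subtype.ext h)),
      fun a => hs (e a).2⟩

end Def

/-! ### Ball types -/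

/-- Codes for rooted graphs with at most `K` vertices. -/
abbrev Code (K : ℕ) : Type := Σ k : Fin (K + 1), SimpleGraph (Fin k) × Fin k

lemma exists_code {V : Type} [Finite V] {G : SimpleGraph V} {d : ℕ} (hd : DegLE G d) (r : ℕ)
    (x : V) : ∃ c : Code ((d + 1) ^ r), BT r c.2.1 c.2.2 G x := by
  have hc := ball_card hd {x} r
  rw [Set.ncard_singleton, one_mul] at hc
  let e := Finite.equivFin (ballSet G r {x})
  rw [← Nat.card_coe_set_eq] at hc
  refine ⟨⟨⟨Nat.card (ballSet G r {x}), by omega⟩,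
    (ballAt G x r).map e.toEmbedding, e (ballRoot G x r)⟩, ?_⟩
  rw [← rootedIso_iff]
  exact ⟨SimpleGraph.Iso.map e _, rfl⟩

/-! ### Locality -/

section Local

open Language

/-- Two graphs agree on a set of sentences. -/
def Agree {V W : Type} (S : Set Language.graph.Sentence) (G : SimpleGraph V) (H : SimpleGraph W) :
    Prop := ∀ σ ∈ S, (gSat G σ ↔ gSat H σ)

lemma LI.adj_iff {V W ι : Type} {G : SimpleGraph V} {H : SimpleGraph W} {r : ℕ} {v : ι → V}
    {w : ι → W} (h : LI r G v H w) (i j : ι) : G.Adj (v i) (v j) ↔ H.Adj (w i) (w j) := by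
  obtain ⟨f, hf, hv⟩ := h
  rw [← hv i, ← hv j]
  exact hf.2 _ (mem_ball_self ⟨i, rfl⟩) _ (mem_ball_self ⟨j, rfl⟩)

lemma LI.eq_iff {V W ι : Type} {G : SimpleGraph V} {H : SimpleGraph W} {r : ℕ} {v : ι → V}
    {w : ι → W} (h : LI r G v H w) (i j : ι) : v i = v j ↔ w i = w j := by
  obtain ⟨f, hf, hv⟩ := h
  rw [← hv i, ← hv j]
  exact ⟨fun e => by rw [e], fun e => hf.1.injOn (mem_ball_self ⟨i, rfl⟩) (mem_ball_self ⟨j, rfl⟩) e⟩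

lemma term_var {α : Type} {n : ℕ} (t : Language.graph.Term (α ⊕ Fin n)) : ∃ i, t = Term.var i := by
  cases t with
  | var i => exact ⟨i, rfl⟩
  | func f _ => exact isEmptyElim f

/-- The extension step of the back-and-forth argument. -/
lemma extend {V W ι : Type} [Finite V] [Finite W] [Finite ι] {G : SimpleGraph V}
    {H : SimpleGraph W} {d : ℕ} (hG : DegLE G d) {r : ℕ} {v : ι → V}
    {w : ι → W} (h : LI (3 * r + 1) G v H w)
    (hcount : ∀ c : Code ((d + 1) ^ r), ∀ m ≤ Nat.card ι * (d + 1) ^ (2 * r + 1) + 1,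
      m ≤ {x | BT r c.2.1 c.2.2 G x}.ncard → m ≤ {x | BT r c.2.1 c.2.2 H x}.ncard) (x : V) :
    ∃ y : W, ∃ f : V → W,
      PI G H f (ballSet G r (Set.range v ∪ {x})) (ballSet H r (Set.range w ∪ {y})) ∧
      (∀ i, f (v i) = w i) ∧ f x = y := by
  obtain ⟨f, hf, hv⟩ := h
  have efv : f '' Set.range v = Set.range w := by
    rw [← Set.range_comp]; congr 1; exact funext hv
  have himg : f '' ballSet G (2 * r + 1) (Set.range v) = ballSet H (2 * r + 1) (Set.range w) := by
    rw [← efv]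
    exact hf.image_ball (ball_mono (by omega) subset_rfl)
      (by rw [efv]; exact ball_mono (by omega) subset_rfl)
  have hsub : ∀ A ⊆ ballSet G (2 * r + 1) (Set.range v),
      PI G H f (ballSet G r A) (ballSet H r (f '' A)) := by
    intro A hA
    refine hf.restrict ?_ ?_
    · exact (ball_mono le_rfl hA).trans (ball_ball.trans (ball_mono (by omega) subset_rfl))
    · have : f '' A ⊆ ballSet H (2 * r + 1) (Set.range w) := by
        rw [← himg]; exact Set.image_mono hA
      exact (ball_mono le_rfl this).trans (ball_ball.trans (ball_mono (by omega) subset_rfl))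
  by_cases hx : x ∈ ballSet G (2 * r + 1) (Set.range v)
  · refine ⟨f x, f, ?_, hv, rfl⟩
    have := hsub (Set.range v ∪ {x}) (Set.union_subset (fun a ha => mem_ball_self ha)
      (Set.singleton_subset_iff.2 hx))
    rwa [Set.image_union, efv, Set.image_singleton] at this
  · obtain ⟨c, hc⟩ := exists_code hG r x
    set A : Set V := {u | u ∈ ballSet G (2 * r + 1) (Set.range v) ∧ BT r c.2.1 c.2.2 G u} with hA
    set A' : Set W := {u | u ∈ ballSet H (2 * r + 1) (Set.range w) ∧ BT r c.2.1 c.2.2 H u} with hA'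
    have hAA : A' ⊆ f '' A := by
      rintro z ⟨hz, hzt⟩
      rw [← himg] at hz
      obtain ⟨u, hu, rfl⟩ := hz
      refine ⟨u, ⟨hu, ?_⟩, rfl⟩
      have hp := hsub {u} (Set.singleton_subset_iff.2 hu)
      rw [Set.image_singleton] at hp
      have : Nonempty V := ⟨u⟩
      obtain ⟨g, hg, hgf⟩ := hp.symm
      have hgu : g (f u) = u := hgf u (mem_ball_self rfl)
      have := hzt.trans_pi (f := g) (H := G) (by rw [hgu]; exact hg)
      rwa [hgu] at this
    have hle : A'.ncard ≤ A.ncard :=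
      (Set.ncard_le_ncard hAA (Set.toFinite _)).trans (Set.ncard_image_le (Set.toFinite _))
    have hAle : A.ncard ≤ Nat.card ι * (d + 1) ^ (2 * r + 1) := by
      refine (Set.ncard_le_ncard (fun u hu => hu.1) (Set.toFinite _)).trans
        ((ball_card hG _ _).trans (Nat.mul_le_mul_right _ ?_))
      rw [← Nat.card_coe_set_eq]
      exact Finite.card_range_le v
    have hxA : x ∉ A := fun h => hx h.1
    have h1 : A.ncard + 1 ≤ {x | BT r c.2.1 c.2.2 G x}.ncard := by
      rw [← Set.ncard_insert_of_notMem hxA (Set.toFinite _)]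
      refine Set.ncard_le_ncard ?_ (Set.toFinite _)
      exact Set.insert_subset hc (fun u hu => hu.2)
    have h2 := hcount c (A.ncard + 1) (by omega) h1
    obtain ⟨y, hy, hyA⟩ : ∃ y ∈ {x | BT r c.2.1 c.2.2 H x}, y ∉ A' := by
      by_contra hcon
      push Not at hcon
      have := Set.ncard_le_ncard (t := A') hcon (Set.toFinite _)
      omega
    have hyf : y ∉ ballSet H (2 * r + 1) (Set.range w) := fun h => hyA ⟨h, hy⟩
    obtain ⟨e, he, hey⟩ := hc.pi hy
    have hfv := hsub (Set.range v) (fun a ha => mem_ball_self ha)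
    rw [efv] at hfv
    have s1 : Sep G (ballSet G r (Set.range v)) (ballSet G r {x}) :=
      sep_balls (by rintro _ rfl; exact hx)
    have s2 : Sep H (ballSet H r (Set.range w)) (ballSet H r {y}) :=
      sep_balls (by rintro _ rfl; exact hyf)
    obtain ⟨F, hF, hFe⟩ := glue (G := G) (H := H) (κ := Bool) (fun b => if b then f else e) f
      (fun b => ballSet G r (if b then Set.range v else {x}))
      (fun b => ballSet H r (if b then Set.range w else {y}))
      (by rintro (_ | _) <;> simpa)
      (by rintro (_ | _) (_ | _) h <;> first | exact absurd rfl h | simpa using s1 | simpa using s1.symm)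
      (by rintro (_ | _) (_ | _) h <;> first | exact absurd rfl h | simpa using s2 | simpa using s2.symm)
    rw [← ball_iUnion, ← ball_iUnion] at hF
    have u1 : (⋃ b : Bool, if b then Set.range v else {x}) = Set.range v ∪ {x} := by
      rw [Set.union_eq_iUnion]; congr 1; funext b; cases b <;> rfl
    have u2 : (⋃ b : Bool, if b then Set.range w else {y}) = Set.range w ∪ {y} := by
      rw [Set.union_eq_iUnion]; congr 1; funext b; cases b <;> rfl
    rw [u1, u2] at hF
    refine ⟨y, F, hF, fun i => ?_, ?_⟩
    · rw [← hv i]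
      exact hFe true (v i) (mem_ball_self (by simp))
    · rw [← hey]
      exact hFe false x (mem_ball_self (by simp))

lemma range_elim_snoc {V α : Type} {n : ℕ} (v : α → V) (xs : Fin n → V) (x : V) :
    Set.range (Sum.elim v (Fin.snoc xs x : Fin (n + 1) → V)) = Set.range (Sum.elim v xs) ∪ {x} := by
  rw [Set.Sum.elim_range, Set.Sum.elim_range, Fin.range_snoc, Set.union_assoc]
  congr 1
  rw [Set.union_comm]; rfl

lemma extend_LI {V W α : Type} {n : ℕ} [Finite V] [Finite W] [Finite α] {G : SimpleGraph V}
    {H : SimpleGraph W} {d : ℕ} (hG : DegLE G d) {r : ℕ} {v : α → V} {xs : Fin n → V}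
    {w : α → W} {ys : Fin n → W} (h : LI (3 * r + 1) G (Sum.elim v xs) H (Sum.elim w ys))
    (hcount : ∀ c : Code ((d + 1) ^ r), ∀ m ≤ Nat.card (α ⊕ Fin n) * (d + 1) ^ (2 * r + 1) + 1,
      m ≤ {x | BT r c.2.1 c.2.2 G x}.ncard → m ≤ {x | BT r c.2.1 c.2.2 H x}.ncard) (x : V) :
    ∃ y : W, LI r G (Sum.elim v (Fin.snoc xs x : Fin (n + 1) → V)) H
      (Sum.elim w (Fin.snoc ys y : Fin (n + 1) → W)) := by
  obtain ⟨y, f, hf, hv, hy⟩ := extend hG h hcount x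
  refine ⟨y, f, ?_, ?_⟩
  · rw [range_elim_snoc, range_elim_snoc]
    exact hf
  · rintro (i | i)
    · exact hv (Sum.inl i)
    · refine Fin.lastCases ?_ (fun j => ?_) i
      · simpa using hy
      · simpa using hv (Sum.inr j)

lemma locality {α : Type} [Finite α] (d : ℕ) {n : ℕ} (φ : Language.graph.BoundedFormula α n) :
    ∃ (r : ℕ) (S : Set Language.graph.Sentence), S.Finite ∧
      ∀ (V W : Type) [Finite V] [Finite W] (G : SimpleGraph V) (H : SimpleGraph W),
        DegLE G d → DegLE H d → Agree S G H →
        ∀ (v : α → V) (xs : Fin n → V) (w : α → W) (ys : Fin n → W),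
          LI r G (Sum.elim v xs) H (Sum.elim w ys) →
          (@BoundedFormula.Realize Language.graph V G.structure α n φ v xs ↔
            @BoundedFormula.Realize Language.graph W H.structure α n φ w ys) := by
  induction φ with
  | falsum => exact ⟨0, ∅, Set.finite_empty, fun _ _ _ _ _ _ _ _ _ _ _ _ _ _ => Iff.rfl⟩
  | equal t₁ t₂ =>
    refine ⟨0, ∅, Set.finite_empty, fun V W _ _ G H _ _ _ v xs w ys h => ?_⟩
    obtain ⟨i, rfl⟩ := term_var t₁
    obtain ⟨j, rfl⟩ := term_var t₂
    exact h.eq_iff i j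
  | rel R ts =>
    refine ⟨0, ∅, Set.finite_empty, fun V W _ _ G H _ _ _ v xs w ys h => ?_⟩
    cases R
    obtain ⟨i, hi⟩ := term_var (ts 0)
    obtain ⟨j, hj⟩ := term_var (ts 1)
    have hadj := h.adj_iff i j
    let _ := G.structure
    let _ := H.structure
    change G.Adj ((ts 0).realize _) ((ts 1).realize _) ↔ H.Adj ((ts 0).realize _) ((ts 1).realize _)
    rw [hi, hj]
    exact hadj
  | imp φ ψ ih₁ ih₂ =>
    obtain ⟨r₁, S₁, f₁, h₁⟩ := ih₁
    obtain ⟨r₂, S₂, f₂, h₂⟩ := ih₂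
    refine ⟨max r₁ r₂, S₁ ∪ S₂, f₁.union f₂, fun V W _ _ G H hG hH hS v xs w ys h => ?_⟩
    have a := h₁ V W G H hG hH (fun σ hσ => hS σ (Or.inl hσ)) v xs w ys (h.mono (le_max_left _ _))
    have b := h₂ V W G H hG hH (fun σ hσ => hS σ (Or.inr hσ)) v xs w ys (h.mono (le_max_right _ _))
    let _ := G.structure
    let _ := H.structure
    rw [BoundedFormula.realize_imp, BoundedFormula.realize_imp, a, b]
  | @all n φ ih =>
    obtain ⟨r, S, fS, hφ⟩ := ih
    choose σ hσ using fun (c : Code ((d + 1) ^ r)) (m : ℕ) =>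
      exists_count_sentence r c.2.1 c.2.2 m
    let M := Nat.card (α ⊕ Fin n) * (d + 1) ^ (2 * r + 1) + 1
    have key : ∀ (V W : Type) [Finite V] [Finite W] (G : SimpleGraph V) (H : SimpleGraph W),
        DegLE G d → DegLE H d →
        Agree (S ∪ Set.range fun p : Code ((d + 1) ^ r) × Fin (M + 1) => σ p.1 p.2) G H →
        ∀ (v : α → V) (xs : Fin n → V) (w : α → W) (ys : Fin n → W),
          LI (3 * r + 1) G (Sum.elim v xs) H (Sum.elim w ys) →
          (@BoundedFormula.Realize Language.graph W H.structure α n φ.all w ys →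
            @BoundedFormula.Realize Language.graph V G.structure α n φ.all v xs) := by
      intro V W _ _ G H hG hH hS v xs w ys h hall x
      obtain ⟨y, hy⟩ := extend_LI hG h (fun c m hm hmG => by
        rw [← hσ c m] at hmG ⊢
        exact (hS _ (Or.inr ⟨(c, ⟨m, by omega⟩), rfl⟩)).1 hmG) x
      exact (hφ V W G H hG hH (fun σ hσ => hS σ (Or.inl hσ)) _ _ _ _ hy).2 (hall y)
    refine ⟨3 * r + 1, S ∪ Set.range fun p : Code ((d + 1) ^ r) × Fin (M + 1) => σ p.1 p.2,
      fS.union (Set.finite_range _), fun V W _ _ G H hG hH hS v xs w ys h => ⟨?_, ?_⟩⟩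
    · intro hall y
      have : Nonempty V := by
        by_contra hV
        rw [not_nonempty_iff] at hV
        have e : ∀ c : Code ((d + 1) ^ r), ¬ BT r c.2.1 c.2.2 H y := by
          intro c hc
          have h1 : 1 ≤ {x | BT r c.2.1 c.2.2 H x}.ncard :=
            (Set.ncard_pos (Set.toFinite _)).2 ⟨y, hc⟩
          have := (hS _ (Or.inr ⟨(c, ⟨1, by omega⟩), rfl⟩)).2 ((hσ c 1 W H).2 h1)
          have := (hσ c 1 V G).1 this
          rw [Set.eq_empty_of_isEmpty {x | BT r c.2.1 c.2.2 G x}] at this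
          simp at this
        obtain ⟨c, hc⟩ := exists_code hH r y
        exact e c hc
      exact key W V H G hH hG (fun σ hσ => (hS σ hσ).symm) w ys v xs h.symm hall y
    · exact key V W G H hG hH hS v xs w ys h

end Local

/-! ### From FO-convergence -/

section Forward

open Language

lemma elem_of_fo {Gs : ℕ → FinGraph} (h : FOConv Gs) : ElemConv Gs := by
  intro φ
  let ψ : Language.graph.Formula (Fin 0) := Formula.relabel (Empty.elim : Empty → Fin 0) φ
  have hψ : ∀ n (v : Fin 0 → (Gs n).V),
      @Formula.Realize Language.graph _ (Gs n).graph.structure _ ψ v ↔ gSat (Gs n).graph φ := by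
    intro n v
    let _ := (Gs n).graph.structure
    rw [Formula.realize_relabel]
    unfold gSat Sentence.Realize
    rw [Subsingleton.elim (v ∘ Empty.elim) default]
  have h1 : ∀ n, gSat (Gs n).graph φ → gDens (Gs n).graph ψ = 1 := by
    intro n hn
    have : Nat.card {v : Fin 0 → (Gs n).V //
        @Formula.Realize Language.graph _ (Gs n).graph.structure _ ψ v} = 1 := by
      rw [Nat.card_eq_one_iff_unique]
      exact ⟨inferInstance, ⟨⟨default, (hψ n _).2 hn⟩⟩⟩
    simp [gDens, this]
  have h0 : ∀ n, ¬ gSat (Gs n).graph φ → gDens (Gs n).graph ψ = 0 := by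
    intro n hn
    have : Nat.card {v : Fin 0 → (Gs n).V //
        @Formula.Realize Language.graph _ (Gs n).graph.structure _ ψ v} = 0 := by
      have : IsEmpty {v : Fin 0 → (Gs n).V //
        @Formula.Realize Language.graph _ (Gs n).graph.structure _ ψ v} :=
        ⟨fun v => hn ((hψ n _).1 v.2)⟩
      exact Nat.card_of_isEmpty
    simp [gDens, this]
  obtain ⟨ℓ, hℓ⟩ := h 0 ψ
  by_cases hl : ℓ < 1 / 2
  · obtain ⟨N, hN⟩ := eventually_atTop.1 (hℓ.eventually (gt_mem_nhds (show ℓ < 1 by linarith)))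
    refine ⟨N, Or.inr fun n hn hs => ?_⟩
    have := hN n hn
    rw [h1 n hs] at this
    exact lt_irrefl _ this
  · obtain ⟨N, hN⟩ := eventually_atTop.1 (hℓ.eventually (lt_mem_nhds (show 0 < ℓ by linarith)))
    refine ⟨N, Or.inl fun n hn => ?_⟩
    by_contra hs
    have := hN n hn
    rw [h0 n hs] at this
    exact lt_irrefl _ this

lemma bs_of_fo {Gs : ℕ → FinGraph} (h : FOConv Gs) : BSConv Gs := by
  intro r W _ F o _
  obtain ⟨φ, hφ⟩ := UD.bt r F o (0 : Fin 1)
  obtain ⟨ℓ, hℓ⟩ := h 1 φ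
  refine ⟨ℓ, hℓ.congr fun n => ?_⟩
  unfold gDens
  rw [pow_one]
  congr 2
  refine Nat.card_congr ((Equiv.funUnique (Fin 1) (Gs n).V).subtypeEquiv fun v => ?_)
  rw [rootedIso_iff]
  exact hφ _ _ v

end Forward

/-! ### Types -/

section Types

/-- The set of codes of the `r`-ball around `x`. -/
def ty {V : Type} (K r : ℕ) (G : SimpleGraph V) (x : V) : Set (Code K) :=
  {c | BT r c.2.1 c.2.2 G x}

lemma ty_eq {V W : Type} {K r : ℕ} {G : SimpleGraph V} {H : SimpleGraph W} {x : V} {y : W}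
    {c : Code K} (hx : BT r c.2.1 c.2.2 G x) (hy : BT r c.2.1 c.2.2 H y) :
    ty K r G x = ty K r H y := by
  ext c'
  obtain ⟨f, hf, rfl⟩ := hx.pi hy
  obtain ⟨g, hg, hgx⟩ := hy.pi hx
  constructor
  · intro h
    exact BT.trans_pi h hf
  · intro h
    have := BT.trans_pi (f := g) (H := G) h (by rw [hgx]; exact hg)
    rwa [hgx] at this

lemma ball_connected {V : Type} (G : SimpleGraph V) (x : V) (r : ℕ) : (ballAt G x r).Connected := by
  have key : ∀ s ≤ r, ∀ u (hu : u ∈ ballSet G r {x}), u ∈ ballSet G s {x} →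
      (ballAt G x r).Reachable (ballRoot G x r) ⟨u, hu⟩ := by
    intro s
    induction s with
    | zero =>
      intro _ u hu hu0
      rw [ball_zero] at hu0
      obtain rfl : u = x := hu0
      exact SimpleGraph.Reachable.refl _
    | succ s ih =>
      intro hs u hu hus
      obtain ⟨z, hz, hzu⟩ := mem_ball_succ.1 hus
      have hz' : z ∈ ballSet G r {x} := ball_mono (by omega) subset_rfl hz
      have := ih (by omega) z hz' hz
      rcases hzu with rfl | hzu
      · exact this
      · refine this.trans (SimpleGraph.Adj.reachable ?_)
        exact hzu
  have : Nonempty (ballSet G r {x}) := ⟨ballRoot G x r⟩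
  refine ⟨fun a b => ?_⟩
  exact (key r le_rfl a.1 a.2 a.2).symm.trans (key r le_rfl b.1 b.2 b.2)

open Classical in
lemma ty_dens {Gs : ℕ → FinGraph} {d : ℕ} (hdeg : ∀ n, DegLE (Gs n).graph d) (h : BSConv Gs)
    (r : ℕ) (T : Set (Code ((d + 1) ^ r))) :
    ∃ ℓ : ℝ, Tendsto (fun n => ((Finset.univ.filter
        fun x : (Gs n).V => ty ((d + 1) ^ r) r (Gs n).graph x = T).card : ℝ) /
      (Nat.card (Gs n).V : ℝ)) atTop (nhds ℓ) := by
  by_cases hT : ∃ n, ∃ x : (Gs n).V, ty ((d + 1) ^ r) r (Gs n).graph x = T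
  · obtain ⟨n, x, rfl⟩ := hT
    obtain ⟨c, hc⟩ := exists_code (hdeg n) r x
    have hconn : c.2.1.Connected := by
      obtain ⟨e, _⟩ := rootedIso_iff.2 hc
      exact e.connected_iff.1 (ball_connected _ _ _)
    obtain ⟨ℓ, hℓ⟩ := h r _ c.2.1 c.2.2 hconn
    refine ⟨ℓ, hℓ.congr fun m => ?_⟩
    congr 2
    rw [Nat.card_eq_fintype_card, Fintype.card_subtype]
    congr 1
    ext y
    simp only [Finset.mem_filter, Finset.mem_univ, true_and, rootedIso_iff]
    constructor
    · intro hy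
      exact ty_eq hy hc
    · intro hy
      have : c ∈ ty ((d + 1) ^ r) r (Gs m).graph y := by rw [hy]; exact hc
      exact this
  · push Not at hT
    refine ⟨0, tendsto_const_nhds.congr fun n => ?_⟩
    rw [Finset.filter_false_of_mem (fun x _ => hT n x)]
    simp

end Types

/-! ### Counting tuples -/

section Count

open Classical in
lemma card_close {V : Type} [Fintype V] {G : SimpleGraph V} {d : ℕ} (hd : DegLE G d) {p : ℕ} (s : ℕ)
    (i j : Fin p) (hij : i ≠ j) :
    (Finset.univ.filter fun v : Fin p → V => v j ∈ ballSet G s {v i}).card * Fintype.card V ≤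
      (d + 1) ^ s * Fintype.card V ^ p := by
  let res : (Fin p → V) → ({k // k ≠ j} → V) := fun v k => v k.1
  have h1 := Finset.card_le_mul_card_image (f := res)
    (Finset.univ.filter fun v : Fin p → V => v j ∈ ballSet G s {v i}) ((d + 1) ^ s) (by
      intro a _
      have hb := ball_card hd {a ⟨i, hij⟩} s
      rw [Set.ncard_singleton, one_mul, Set.ncard_eq_toFinset_card'] at hb
      refine le_trans ?_ hb
      refine Finset.card_le_card_of_injOn (fun v => v j) ?_ ?_
      · intro v hv
        simp only [Finset.coe_filter, Finset.mem_filter, Finset.mem_univ, true_and,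
          Set.mem_ofPred_eq] at hv
        obtain ⟨hv, rfl⟩ := hv
        simpa using hv
      · intro v hv v' hv' e
        simp only [Finset.coe_filter, Finset.mem_filter, Finset.mem_univ, true_and,
          Set.mem_ofPred_eq] at hv hv'
        funext k
        by_cases hk : k = j
        · rw [hk]; exact e
        · exact congrFun (hv.2.trans hv'.2.symm) ⟨k, hk⟩)
  have h2 : (Finset.image res (Finset.univ.filter fun v : Fin p → V =>
      v j ∈ ballSet G s {v i})).card ≤ Fintype.card V ^ (p - 1) := by
    refine (Finset.card_le_univ _).trans ?_
    rw [Fintype.card_fun, Fintype.card_subtype_compl]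
    simp
  have hp : p = (p - 1) + 1 := by have := i.2; omega
  calc _ ≤ ((d + 1) ^ s * Fintype.card V ^ (p - 1)) * Fintype.card V :=
        Nat.mul_le_mul_right _ (h1.trans (Nat.mul_le_mul_left _ h2))
    _ = (d + 1) ^ s * Fintype.card V ^ p := by
        rw [mul_assoc, ← pow_succ, ← hp]

/-- Pairwise far tuples. -/
def Far {V : Type} {p : ℕ} (s : ℕ) (G : SimpleGraph V) (v : Fin p → V) : Prop :=
  ∀ i j, i ≠ j → v j ∉ ballSet G s {v i}

open Classical in
lemma card_not_far {V : Type} [Fintype V] {G : SimpleGraph V} {d : ℕ} (hd : DegLE G d) (p s : ℕ) :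
    (Finset.univ.filter fun v : Fin p → V => ¬ Far s G v).card * Fintype.card V ≤
      (p * p) * ((d + 1) ^ s * Fintype.card V ^ p) := by
  have hsub : (Finset.univ.filter fun v : Fin p → V => ¬ Far s G v) ⊆
      (Finset.univ.filter fun q : Fin p × Fin p => q.1 ≠ q.2).biUnion fun q =>
        Finset.univ.filter fun v : Fin p → V => v q.2 ∈ ballSet G s {v q.1} := by
    intro v hv
    simp only [Far, Finset.mem_filter, Finset.mem_univ, true_and, not_forall, not_not] at hv
    obtain ⟨i, j, hij, h⟩ := hv
    simp only [Finset.mem_biUnion, Finset.mem_filter, Finset.mem_univ, true_and]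
    exact ⟨(i, j), hij, h⟩
  calc _ ≤ (∑ q ∈ (Finset.univ.filter fun q : Fin p × Fin p => q.1 ≠ q.2),
        (Finset.univ.filter fun v : Fin p → V => v q.2 ∈ ballSet G s {v q.1}).card)
          * Fintype.card V :=
        Nat.mul_le_mul_right _ ((Finset.card_le_card hsub).trans Finset.card_biUnion_le)
    _ = ∑ q ∈ (Finset.univ.filter fun q : Fin p × Fin p => q.1 ≠ q.2),
        (Finset.univ.filter fun v : Fin p → V => v q.2 ∈ ballSet G s {v q.1}).card
          * Fintype.card V := Finset.sum_mul _ _ _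
    _ ≤ ∑ q ∈ (Finset.univ.filter fun q : Fin p × Fin p => q.1 ≠ q.2),
          ((d + 1) ^ s * Fintype.card V ^ p) :=
        Finset.sum_le_sum fun q hq => card_close hd s q.1 q.2 (Finset.mem_filter.1 hq).2
    _ ≤ _ := by
        rw [Finset.sum_const, smul_eq_mul]
        refine Nat.mul_le_mul_right _ ((Finset.card_le_univ _).trans ?_)
        simp

lemma far_LI {V W : Type} [Finite V] [Finite W] [Nonempty W] {G : SimpleGraph V}
    {H : SimpleGraph W} {d : ℕ} (hG : DegLE G d) {p r : ℕ} {v : Fin p → V} {w : Fin p → W}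
    (hv : Far (2 * r + 1) G v) (hw : Far (2 * r + 1) H w)
    (hvw : ∀ i, ty ((d + 1) ^ r) r G (v i) = ty ((d + 1) ^ r) r H (w i)) : LI r G v H w := by
  have hf : ∀ i, ∃ f, PI G H f (ballSet G r {v i}) (ballSet H r {w i}) ∧ f (v i) = w i := by
    intro i
    obtain ⟨c, hc⟩ := exists_code hG r (v i)
    have hc' : c ∈ ty ((d + 1) ^ r) r H (w i) := by rw [← hvw i]; exact hc
    exact hc.pi hc'
  choose f hf hfe using hf
  obtain ⟨F, hF, hFe⟩ := glue f (fun _ => Classical.arbitrary W) _ _ hf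
    (fun k l hkl => sep_balls (by rintro _ rfl; exact hv k l hkl))
    (fun k l hkl => sep_balls (by rintro _ rfl; exact hw k l hkl))
  rw [← ball_iUnion, ← ball_iUnion, Set.iUnion_singleton_eq_range,
    Set.iUnion_singleton_eq_range] at hF
  exact ⟨F, hF, fun i => (hFe i _ (mem_ball_self rfl)).trans (hfe i)⟩

open Classical in
lemma card_types {V : Type} [Fintype V] {Q : Type} [Fintype Q] {p : ℕ} (t : V → Q)
    (Good : Finset (Fin p → Q)) :
    (Finset.univ.filter fun v : Fin p → V => (fun i => t (v i)) ∈ Good).card =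
      ∑ τ ∈ Good, ∏ i, (Finset.univ.filter fun x : V => t x = τ i).card := by
  rw [Finset.card_eq_sum_card_fiberwise (f := fun (v : Fin p → V) i => t (v i)) (t := Good)
    (by intro v hv; simpa using hv)]
  refine Finset.sum_congr rfl fun τ hτ => ?_
  rw [← Fintype.card_piFinset]
  congr 1
  ext v
  simp only [Finset.mem_filter, Finset.mem_univ, true_and, Fintype.mem_piFinset]
  constructor
  · rintro ⟨_, h⟩ i
    exact congrFun h i
  · intro h
    have : (fun i => t (v i)) = τ := funext h
    exact ⟨this ▸ hτ, this⟩

end Count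

/-! ### Main direction -/

section Main

open Language

open Classical in
lemma fo_of_bs_elem {d : ℕ} {Gs : ℕ → FinGraph} (hdeg : ∀ n, DegLE (Gs n).graph d)
    (hcard : Tendsto (fun n => Nat.card (Gs n).V) atTop atTop) (hBS : BSConv Gs)
    (hE : ElemConv Gs) : FOConv Gs := by
  intro p φ
  obtain ⟨r, S, hS, hloc⟩ := locality d φ
  have hN : ∃ N, ∀ n ≥ N, ∀ m ≥ N, Agree S (Gs n).graph (Gs m).graph := by
    choose N hN using hE
    obtain ⟨M, hM⟩ := (hS.image N).bddAbove
    refine ⟨M, fun n hn m hm σ hσ => ?_⟩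
    have hle : N σ ≤ M := hM ⟨σ, hσ, rfl⟩
    rcases hN σ with h | h
    · exact iff_of_true (h n (hle.trans hn)) (h m (hle.trans hm))
    · exact iff_of_false (h n (hle.trans hn)) (h m (hle.trans hm))
  obtain ⟨N, hN⟩ := hN
  let R : ∀ n, (Fin p → (Gs n).V) → Prop := fun n v =>
    @Formula.Realize Language.graph _ (Gs n).graph.structure _ φ v
  let Q := Set (Code ((d + 1) ^ r))
  let t : ∀ n, (Gs n).V → Q := fun n => ty ((d + 1) ^ r) r (Gs n).graph
  have : Fintype Q := Fintype.ofFinite _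
  let Good : Finset (Fin p → Q) := Finset.univ.filter fun τ => ∃ n ≥ N, ∃ v : Fin p → (Gs n).V,
    Far (2 * r + 1) (Gs n).graph v ∧ (fun i => t n (v i)) = τ ∧ R n v
  have hgood : ∀ n ≥ N, ∀ v : Fin p → (Gs n).V, Far (2 * r + 1) (Gs n).graph v →
      (R n v ↔ (fun i => t n (v i)) ∈ Good) := by
    intro n hn v hv
    simp only [Good, Finset.mem_filter, Finset.mem_univ, true_and]
    constructor
    · intro h
      exact ⟨n, hn, v, hv, rfl, h⟩
    · rintro ⟨m, hm, w, hw, hwv, hR⟩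
      have hli := far_LI (hdeg m) hw hv (fun i => congrFun hwv i)
      have hli' : LI r (Gs m).graph (Sum.elim w (default : Fin 0 → (Gs m).V))
          (Gs n).graph (Sum.elim v (default : Fin 0 → (Gs n).V)) := by
        obtain ⟨f, hf, hfe⟩ := hli
        refine ⟨f, ?_, ?_⟩
        · simpa [Set.Sum.elim_range] using hf
        · rintro (i | i)
          · exact hfe i
          · exact i.elim0
      exact (hloc _ _ _ _ (hdeg m) (hdeg n) (hN m hm n hn) _ _ _ _ hli').1 hR
  -- the approximating sequence
  let g : ℕ → ℝ := fun n => ∑ τ ∈ Good, ∏ i, (((Finset.univ.filter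
    fun x : (Gs n).V => t n x = τ i).card : ℝ) / (Nat.card (Gs n).V : ℝ))
  choose ℓ hℓ using ty_dens hdeg hBS r
  have hg : Tendsto g atTop (nhds (∑ τ ∈ Good, ∏ i, ℓ (τ i))) :=
    tendsto_finsetSum _ fun τ _ => tendsto_finsetProd _ fun i _ => hℓ (τ i)
  have hgeq : ∀ n, g n = ((Finset.univ.filter fun v : Fin p → (Gs n).V =>
      (fun i => t n (v i)) ∈ Good).card : ℝ) / (Nat.card (Gs n).V : ℝ) ^ p := by
    intro n
    have e : (Finset.univ.filter fun v : Fin p → (Gs n).V => (fun i => t n (v i)) ∈ Good).card =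
        ∑ τ ∈ Good, ∏ i, (Finset.univ.filter fun x : (Gs n).V => t n x = τ i).card := by
      convert card_types (t n) Good
    rw [e]
    push_cast
    rw [Finset.sum_div]
    refine Finset.sum_congr rfl fun τ _ => ?_
    rw [Finset.prod_div_distrib]
    simp
  have hbound : ∀ n ≥ N, |gDens (Gs n).graph φ - g n| ≤
      ((p * p * (d + 1) ^ (2 * r + 1) : ℕ) : ℝ) / (Nat.card (Gs n).V : ℝ) := by
    intro n hn
    have hD : gDens (Gs n).graph φ = ((Finset.univ.filter (R n)).card : ℝ) /
        (Nat.card (Gs n).V : ℝ) ^ p := by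
      unfold gDens
      congr 2
      rw [Nat.card_eq_fintype_card, Fintype.card_subtype]
    rw [hD, hgeq]
    set X := Finset.univ.filter (R n) with hX
    set Y := Finset.univ.filter fun v : Fin p → (Gs n).V => (fun i => t n (v i)) ∈ Good with hY
    set B := Finset.univ.filter fun v : Fin p → (Gs n).V => ¬ Far (2 * r + 1) (Gs n).graph v with hB
    have hXY : X ⊆ Y ∪ B := by
      intro v hv
      simp only [hX, hY, hB, Finset.mem_union, Finset.mem_filter, Finset.mem_univ, true_and] at hv ⊢
      by_cases hf : Far (2 * r + 1) (Gs n).graph v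
      · exact Or.inl ((hgood n hn v hf).1 hv)
      · exact Or.inr hf
    have hYX : Y ⊆ X ∪ B := by
      intro v hv
      simp only [hX, hY, hB, Finset.mem_union, Finset.mem_filter, Finset.mem_univ, true_and] at hv ⊢
      by_cases hf : Far (2 * r + 1) (Gs n).graph v
      · exact Or.inl ((hgood n hn v hf).2 hv)
      · exact Or.inr hf
    have c1 : (X.card : ℝ) ≤ Y.card + B.card := by
      exact_mod_cast (Finset.card_le_card hXY).trans (Finset.card_union_le _ _)
    have c2 : (Y.card : ℝ) ≤ X.card + B.card := by
      exact_mod_cast (Finset.card_le_card hYX).trans (Finset.card_union_le _ _)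
    have c3 : (B.card : ℝ) * (Nat.card (Gs n).V : ℝ) ≤
        ((p * p * (d + 1) ^ (2 * r + 1) : ℕ) : ℝ) * (Nat.card (Gs n).V : ℝ) ^ p := by
      have := card_not_far (hdeg n) p (2 * r + 1)
      rw [← Nat.card_eq_fintype_card, ← mul_assoc] at this
      exact_mod_cast this
    have hpos : (0 : ℝ) < Nat.card (Gs n).V := by exact_mod_cast Nat.card_pos
    have hpp : (0 : ℝ) < (Nat.card (Gs n).V : ℝ) ^ p := pow_pos hpos p
    rw [← sub_div, abs_div, abs_of_pos hpp]
    calc _ ≤ (B.card : ℝ) / (Nat.card (Gs n).V : ℝ) ^ p := by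
          gcongr
          rw [abs_le]
          constructor <;> linarith
      _ ≤ _ := by
          rw [div_le_div_iff₀ hpp hpos]
          exact c3
  have hz : Tendsto (fun n => ((p * p * (d + 1) ^ (2 * r + 1) : ℕ) : ℝ) /
      (Nat.card (Gs n).V : ℝ)) atTop (nhds 0) :=
    tendsto_const_nhds.div_atTop (tendsto_natCast_atTop_atTop.comp hcard)
  have hdiff : Tendsto (fun n => gDens (Gs n).graph φ - g n) atTop (nhds 0) := by
    refine squeeze_zero_norm' ?_ hz
    filter_upwards [eventually_ge_atTop N] with n hn
    exact hbound n hn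
  refine ⟨_, (hdiff.add hg).congr fun n => ?_⟩
  ring

end Main

end FOBS

/-- A sequence `(G_n)` of finite graphs with maximum degree at most `d` and
`|G_n| → ∞` is `FO`-convergent if and only if it is both BS-convergent and elementarily
convergent. -/
theorem foConv_iff_bsConv_and_elemConv (d : ℕ) (Gs : ℕ → FinGraph)
    (hdeg : ∀ n, DegLE (Gs n).graph d)
    (hcard : Tendsto (fun n => Nat.card (Gs n).V) atTop atTop) :
    FOConv Gs ↔ (BSConv Gs ∧ ElemConv Gs) := by
  exact ⟨fun h => ⟨FOBS.bs_of_fo h, FOBS.elem_of_fo h⟩, fun h => FOBS.fo_of_bs_elem hdeg hcard h.1 h.2⟩
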